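/- Let L > 0 be a real number, and consider the set of 60 rectangular tiles consisting of 20 copies each of the rectangles 1 × L, 2 × L, and 3 × L. For every divisor f of 120 with f ≥ 3 (namely f ∈ {3, 4, 5, 6, 8, 10, 12, 15, 20, 24, 30, 40, 60, 120}, a total of 14 values), this tile set tiles a rectangle of dimensions f × (120L/f). -/

import Mathlib

/-- The axis-aligned `w × h` rectangle `[0,w] × [0,h]` in the plane. -/
def rectWH (w h : ℝ) : Set (ℝ × ℝ) := Set.Icc 0 w ×ˢ Set.Icc 0 h

/-- `S` is a placement of a `w × h` rectangle: a translate of `[0,w] × [0,h]`, optionally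
preceded by a 90° rotation (which interchanges the roles of `w` and `h`). -/
def IsPlacement (w h : ℝ) (S : Set (ℝ × ℝ)) : Prop :=
  ∃ v : ℝ × ℝ, S = (fun p => p + v) '' rectWH w h ∨ S = (fun p => p + v) '' rectWH h w

/-- The tile set `dims` (of `n` rectangles) tiles a `W × H` rectangle: there exist placements
of the tiles with pairwise disjoint interiors whose union is `[0,W] × [0,H]`. -/
def TilesRect {n : ℕ} (dims : Fin n → ℝ × ℝ) (W H : ℝ) : Prop :=
  ∃ P : Fin n → Set (ℝ × ℝ),
    (∀ i, IsPlacement (dims i).1 (dims i).2 (P i)) ∧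
    (∀ i j, i ≠ j → interior (P i) ∩ interior (P j) = ∅) ∧
    (⋃ i, P i) = rectWH W H

/-- The 60 tiles: 20 copies each of the rectangles `1 × L`, `2 × L` and `3 × L`. -/
noncomputable def dims11 (L : ℝ) : Fin 60 → ℝ × ℝ :=
  fun i => ((((i : ℕ) / 20 + 1 : ℕ) : ℝ), L)

/-- The segments `[s i, s i + w i)` partition `{0, …, N - 1}`, and none of them crosses a multiple
of `k`. -/
structure IsSegmentPartition {n : ℕ} (w s : Fin n → ℕ) (k N : ℕ) : Prop where
  cover : ∀ t < N, ∃ i, s i ≤ t ∧ t < s i + w i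
  bound : ∀ i, s i + w i ≤ N
  disjoint : ∀ i j, i ≠ j → s i + w i ≤ s j ∨ s j + w j ≤ s i
  fits : ∀ i, s i % k + w i ≤ k

theorem IsSegmentPartition.mono_dvd {n : ℕ} {w s : Fin n → ℕ} {k f N : ℕ}
    (h : IsSegmentPartition w s k N) (hkf : k ∣ f) (hf : 0 < f) :
    IsSegmentPartition w s f N := by
  refine ⟨h.cover, h.bound, h.disjoint, fun i => ?_⟩
  obtain ⟨m, rfl⟩ := hkf
  have hm : 0 < m := Nat.pos_of_mul_pos_left hf
  have hlt : s i / k % m + 1 ≤ m := Nat.mod_lt _ hm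
  have hmul := Nat.mul_le_mul_left k hlt
  have hfit := h.fits i
  rw [Nat.mod_mul]
  rw [Nat.mul_add, Nat.mul_one] at hmul
  omega

theorem image_add_rectWH (w h : ℝ) (v : ℝ × ℝ) :
    (fun p => p + v) '' rectWH w h =
      Set.Icc v.1 (v.1 + w) ×ˢ Set.Icc v.2 (v.2 + h) := by
  ext ⟨x, y⟩
  simp only [rectWH, Set.mem_image, Set.mem_prod, Set.mem_Icc, Prod.exists, Prod.ext_iff,
    Prod.fst_add, Prod.snd_add]
  constructor
  · rintro ⟨a, b, h, rfl, rfl⟩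
    refine ⟨⟨?_, ?_⟩, ?_, ?_⟩ <;> linarith [h.1.1, h.1.2, h.2.1, h.2.2]
  · rintro h
    refine ⟨x - v.1, y - v.2, ⟨⟨?_, ?_⟩, ?_, ?_⟩, by ring, by ring⟩ <;>
      linarith [h.1.1, h.1.2, h.2.1, h.2.2]

theorem exists_unit_cell {n : ℕ} (hn : 0 < n) {x : ℝ} (hx : 0 ≤ x) (hxn : x ≤ n) :
    ∃ c < n, (c : ℝ) ≤ x ∧ x ≤ c + 1 := by
  rcases hxn.lt_or_eq with h | rfl
  · exact ⟨⌊x⌋₊, (Nat.floor_lt hx).2 h, Nat.floor_le hx, (Nat.lt_floor_add_one x).le⟩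
  · refine ⟨n - 1, by omega, ?_, ?_⟩ <;> push_cast [Nat.cast_sub hn] <;> linarith

/-- A segment partition of `{0, …, f * r - 1}` into segments not crossing multiples of `f`, folded
into `r` rows of length `f` and height `L`, is a tiling of an `f × (r * L)` rectangle. -/
theorem IsSegmentPartition.tilesRect {n : ℕ} {w s : Fin n → ℕ} {f r : ℕ}
    (h : IsSegmentPartition w s f (f * r)) (hf : 0 < f) (hr : 0 < r) (hw : ∀ i, 0 < w i)
    {L : ℝ} (hL : 0 < L) :
    TilesRect (fun i => ((w i : ℝ), L)) (f : ℝ) (r * L) := by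
  have hrow : ∀ i, s i / f < r := fun i =>
    Nat.div_lt_of_lt_mul (by have := h.bound i; have := hw i; omega)
  refine ⟨fun i => Set.Icc ((s i % f : ℕ) : ℝ) ((s i % f : ℕ) + w i) ×ˢ
    Set.Icc ((s i / f : ℕ) * L) ((s i / f : ℕ) * L + L), fun i => ?_, fun i j hij => ?_, ?_⟩
  · exact ⟨(((s i % f : ℕ) : ℝ), (s i / f : ℕ) * L), Or.inl (by rw [image_add_rectWH])⟩
  · simp only [interior_prod_eq, interior_Icc]
    refine Set.eq_empty_iff_forall_notMem.2 ?_
    rintro ⟨x, y⟩ ⟨⟨⟨hx₁, hx₂⟩, hy₁, hy₂⟩, ⟨hx₃, hx₄⟩, hy₃, hy₄⟩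
    simp only at hx₁ hx₂ hx₃ hx₄ hy₁ hy₂ hy₃ hy₄
    have hrows : s i / f = s j / f := by
      have h₁ : ((s i / f : ℕ) : ℝ) < (s j / f : ℕ) + 1 := by nlinarith
      have h₂ : ((s j / f : ℕ) : ℝ) < (s i / f : ℕ) + 1 := by nlinarith
      norm_cast at h₁ h₂
      omega
    have h₁ : ((s i % f : ℕ) : ℝ) < (s j % f : ℕ) + w j := by linarith
    have h₂ : ((s j % f : ℕ) : ℝ) < (s i % f : ℕ) + w i := by linarith
    norm_cast at h₁ h₂
    have hi := Nat.div_add_mod (s i) f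
    have hj := Nat.div_add_mod (s j) f
    rw [hrows] at hi
    have := h.disjoint i j hij
    omega
  · ext ⟨x, y⟩
    simp only [rectWH, Set.mem_iUnion, Set.mem_prod, Set.mem_Icc]
    constructor
    · rintro ⟨i, ⟨hx₁, hx₂⟩, hy₁, hy₂⟩
      have hfit : ((s i % f : ℕ) : ℝ) + w i ≤ f := by exact_mod_cast h.fits i
      have hrow' : ((s i / f : ℕ) : ℝ) + 1 ≤ r := by exact_mod_cast hrow i
      refine ⟨⟨(Nat.cast_nonneg _).trans hx₁, hx₂.trans hfit⟩, le_trans (by positivity) hy₁, ?_⟩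
      nlinarith
    · rintro ⟨⟨hx₁, hx₂⟩, hy₁, hy₂⟩
      obtain ⟨c, hcf, hc₁, hc₂⟩ := exists_unit_cell hf hx₁ hx₂
      obtain ⟨b, hbr, hb₁, hb₂⟩ := exists_unit_cell hr (div_nonneg hy₁ hL.le)
        ((div_le_iff₀ hL).2 hy₂)
      rw [le_div_iff₀ hL] at hb₁
      rw [div_le_iff₀ hL] at hb₂
      have hlt : f * b + c < f * r := by
        have := Nat.mul_le_mul_left f (Nat.succ_le_of_lt hbr)
        rw [Nat.mul_succ] at this
        omega
      obtain ⟨i, hi₁, hi₂⟩ := h.cover _ hlt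
      have hdm := Nat.div_add_mod (s i) f
      have hfit := h.fits i
      have hb : s i / f = b := by
        refine le_antisymm ?_ ?_
        · refine Nat.le_of_lt_succ (Nat.div_lt_of_lt_mul ?_)
          rw [Nat.mul_succ]
          omega
        · refine Nat.le_of_lt_succ (Nat.lt_of_mul_lt_mul_left (a := f) ?_)
          rw [Nat.mul_succ]
          omega
      rw [hb] at hdm
      have hc₃ : ((s i % f : ℕ) : ℝ) ≤ c := by
        have : s i % f ≤ c := by omega
        exact_mod_cast this
      have hc₄ : (c : ℝ) + 1 ≤ (s i % f : ℕ) + w i := by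
        have : c + 1 ≤ s i % f + w i := by omega
        exact_mod_cast this
      refine ⟨i, ⟨hc₃.trans hc₁, hc₂.trans hc₄⟩, ?_, ?_⟩ <;> rw [hb] <;> linarith

/-- The lengths `1`, `2`, `3`, each occurring twenty times. -/
def tileLength (i : Fin 60) : ℕ := i / 20 + 1

/-- Twenty blocks `1 + 2` followed by twenty blocks `3`. -/
def startThree (i : Fin 60) : ℕ :=
  if (i : ℕ) < 20 then 3 * i
  else if (i : ℕ) < 40 then 3 * (i - 20) + 1
  else 60 + 3 * (i - 40)

/-- Twenty blocks `1 + 3` followed by ten blocks `2 + 2`. -/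
def startFour (i : Fin 60) : ℕ :=
  if (i : ℕ) < 20 then 4 * i
  else if (i : ℕ) < 40 then 80 + 2 * (i - 20)
  else 4 * (i - 40) + 1

/-- Eight blocks `1 + 1 + 3`, then four blocks `1 + 2 + 2`, then twelve blocks `2 + 3`. -/
def startFive (i : Fin 60) : ℕ :=
  if (i : ℕ) < 16 then 5 * (i / 2) + i % 2
  else if (i : ℕ) < 20 then 40 + 5 * (i - 16)
  else if (i : ℕ) < 28 then 41 + 5 * ((i - 20) / 2) + 2 * (i % 2)
  else if (i : ℕ) < 40 then 60 + 5 * (i - 28)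
  else if (i : ℕ) < 48 then 5 * (i - 40) + 2
  else 62 + 5 * (i - 48)

theorem isSegmentPartition_startThree : IsSegmentPartition tileLength startThree 3 120 := by
  constructor <;> decide +kernel

theorem isSegmentPartition_startFour : IsSegmentPartition tileLength startFour 4 120 := by
  constructor <;> decide +kernel

theorem isSegmentPartition_startFive : IsSegmentPartition tileLength startFive 5 120 := by
  constructor <;> decide +kernel

theorem exists_isSegmentPartition_tileLength {f : ℕ} (hf : f ∣ 120) (hf3 : 3 ≤ f) :
    ∃ s, IsSegmentPartition tileLength s f 120 := by
  have hdvd : 3 ∣ f ∨ 4 ∣ f ∨ 5 ∣ f := by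
    have hle : f ≤ 120 := Nat.le_of_dvd (by norm_num) hf
    interval_cases f <;> omega
  have hpos : 0 < f := by omega
  rcases hdvd with h | h | h
  · exact ⟨_, isSegmentPartition_startThree.mono_dvd h hpos⟩
  · exact ⟨_, isSegmentPartition_startFour.mono_dvd h hpos⟩
  · exact ⟨_, isSegmentPartition_startFive.mono_dvd h hpos⟩

/-- For every `L > 0` and every divisor `f` of `120` with `f ≥ 3`, the set of 60 tiles
consisting of 20 copies each of `1 × L`, `2 × L` and `3 × L` tiles an `f × (120L/f)`
rectangle. -/
theorem sixty_tiles_layouts (L : ℝ) (hL : 0 < L) (f : ℕ) (hf : f ∣ 120) (hf3 : 3 ≤ f) :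
    TilesRect (dims11 L) (f : ℝ) (120 * L / (f : ℝ)) := by
  obtain ⟨s, hs⟩ := exists_isSegmentPartition_tileLength hf hf3
  obtain ⟨r, hr⟩ := hf
  have hfpos : 0 < f := by omega
  have hrpos : 0 < r := Nat.pos_of_ne_zero (by rintro rfl; simp at hr)
  rw [hr] at hs
  have hheight : 120 * L / (f : ℝ) = r * L := by
    have hcast : (120 : ℝ) = f * r := by exact_mod_cast hr
    rw [hcast]
    field_simp
  rw [hheight]
  exact hs.tilesRect hfpos hrpos (fun i => Nat.succ_pos _) hL
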